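/- Let h : ℝ⁴ → ℝ be a harmonic polynomial (Δh = 0) that is homogeneous of degree k ≥ 0, and let F(x) := (‖x‖² − 1) h(x). Then on the unit sphere S³: the inward normal derivative satisfies μ F(x) := −⟨∇F(x), x⟩ = −2 h(x) for all x ∈ S³; and P₃^{S³} F = 0, i.e. (1/2)μ(ΔF) + Δ_{S³}(μF) − Δ_{S³}(F|_{S³}) = 0 on S³. -/

import Mathlib

noncomputable section

open Real Set
open scoped RealInnerProductSpace Topology

abbrev E4 := EuclideanSpace ℝ (Fin 4)

def e4 (i : Fin 4) : E4 := EuclideanSpace.single i 1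

/-- Euclidean Laplacian on `ℝ⁴`. -/
def lap (u : E4 → ℝ) (x : E4) : ℝ :=
  ∑ i : Fin 4, fderiv ℝ (fun y => fderiv ℝ u y (e4 i)) x (e4 i)

/-- Laplacian in the first three variables. -/
def lap3 (u : E4 → ℝ) (x : E4) : ℝ :=
  ∑ i : Fin 3, fderiv ℝ (fun y => fderiv ℝ u y (e4 i.castSucc)) x (e4 i.castSucc)

/-- Spherical Laplacian of (the restriction to `S³` of) `f`, via the `0`-homogeneous
extension `y ↦ f (y / ‖y‖)`. -/
def sphLap (f : E4 → ℝ) (x : E4) : ℝ := lap (fun y => f (‖y‖⁻¹ • y)) x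

/-- Inward normal derivative at a point of the unit sphere: `μ_M u x = -⟨∇u x, x⟩`. -/
def muM (u : E4 → ℝ) (x : E4) : ℝ := -(fderiv ℝ u x x)

/-- Inward normal derivative at a point of the flat boundary `B³ ⊂ {x₄ = 0}`. -/
def muN (u : E4 → ℝ) (x : E4) : ℝ := fderiv ℝ u x (e4 3)

/-- At `p ∈ Σ`, `ν_M f p = -(d/dφ)|_{φ = π/2} f(sin φ • σ, cos φ)`. -/
def nuM (f : E4 → ℝ) (p : E4) : ℝ :=
  -(deriv (fun t : ℝ => f (Real.sin t • p + Real.cos t • e4 3)) (π/2))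

/-- At `p ∈ Σ`, `ν_N f p = -(d/dr)|_{r = 1} f (r • p)`. -/
def nuN (f : E4 → ℝ) (p : E4) : ℝ := -(deriv (fun r : ℝ => f (r • p)) 1)

/-- The closed upper half-ball `B⁴₊`. -/
def B4p : Set E4 := {x | ‖x‖ ≤ 1 ∧ 0 ≤ x 3}
/-- The upper half-sphere `M = S³₊`. -/
def Mhs : Set E4 := {x | ‖x‖ = 1 ∧ 0 ≤ x 3}
/-- The flat boundary `N = B³`. -/
def Nfb : Set E4 := {x | ‖x‖ ≤ 1 ∧ x 3 = 0}
/-- The corner `Σ = S²`. -/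
def Sig : Set E4 := {x | ‖x‖ = 1 ∧ x 3 = 0}

/-- `P₃^M u = (1/2) μ_M (Δu) + Δ_{S³}(μ_M u) - Δ_{S³}(u|_M)`. -/
def P3M (u : E4 → ℝ) (x : E4) : ℝ :=
  (1/2) * muM (lap u) x + sphLap (muM u) x - sphLap u x

/-- `P₃^N u = (1/2) μ_N (Δu) + Δ_{ℝ³}(μ_N u)`. -/
def P3N (u : E4 → ℝ) (x : E4) : ℝ :=
  (1/2) * muN (lap u) x + lap3 (muN u) x


/-- `h` is (the function associated to) a real polynomial in the four coordinates. -/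
def IsPolyFun (h : E4 → ℝ) : Prop :=
  ∃ P : MvPolynomial (Fin 4) ℝ, ∀ x : E4, h x = MvPolynomial.eval (fun i => x i) P

theorem IsPolyFun.contDiff {h : E4 → ℝ} (hpoly : IsPolyFun h) {n : WithTop ℕ∞} :
    ContDiff ℝ n h := by
  obtain ⟨P, hP⟩ := hpoly
  have hfun : h = fun x : E4 => MvPolynomial.eval (fun i => x i) P := funext hP
  rw [hfun]
  induction P using MvPolynomial.induction_on generalizing h with
  | C a => simpa using contDiff_const
  | add p q hp hq =>
    simpa using (hp (fun _ => rfl) rfl).add (hq (fun _ => rfl) rfl)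
  | mul_X p i hp =>
    have hi : ContDiff ℝ n (fun x : E4 => x i) := by fun_prop
    simpa using (hp (fun _ => rfl) rfl).mul hi

/-- Euler's identity for homogeneous functions. -/
theorem fderiv_self_of_homogeneous {E : Type*} [NormedAddCommGroup E] [NormedSpace ℝ E]
    {k : ℕ} {h : E → ℝ} (hhom : ∀ (t : ℝ) (x : E), h (t • x) = t ^ k * h x) {x : E}
    (hd : DifferentiableAt ℝ h x) : fderiv ℝ h x x = k * h x := by
  have h₁ : HasDerivAt (fun t : ℝ => h (t • x)) (fderiv ℝ h x x) 1 := by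
    have hs : HasDerivAt (fun t : ℝ => t • x) x 1 := by
      simpa using (hasDerivAt_id (1 : ℝ)).smul_const x
    have hd' : HasFDerivAt h (fderiv ℝ h x) ((1 : ℝ) • x) := by
      simpa using hd.hasFDerivAt
    exact hd'.comp_hasDerivAt 1 hs
  have h₂ : HasDerivAt (fun t : ℝ => h (t • x)) (k * h x) 1 := by
    simp only [hhom]
    simpa using (hasDerivAt_pow k (1 : ℝ)).mul_const (h x)
  exact h₁.unique h₂

theorem sum_apply_mul_clm (L : E4 →L[ℝ] ℝ) (x : E4) : ∑ i, x i * L (e4 i) = L x := by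
  conv_rhs => rw [← (EuclideanSpace.basisFun (Fin 4) ℝ).sum_repr x]
  simp [e4]

theorem lap_congr {u v : E4 → ℝ} {x : E4} (huv : u =ᶠ[𝓝 x] v) : lap u x = lap v x := by
  unfold lap
  refine Finset.sum_congr rfl fun i _ => ?_
  have hev : (fun y => fderiv ℝ u y (e4 i)) =ᶠ[𝓝 x] fun y => fderiv ℝ v y (e4 i) := by
    filter_upwards [huv.fderiv (𝕜 := ℝ)] with y hy
    rw [hy]
  rw [hev.fderiv_eq]

theorem lap_const_mul (c : ℝ) (u : E4 → ℝ) (x : E4) :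
    lap (fun y => c * u y) x = c * lap u x := by
  simp only [lap, Finset.mul_sum]
  refine Finset.sum_congr rfl fun i _ => ?_
  have hu : (fun y => fderiv ℝ (fun z => c * u z) y (e4 i))
      = fun y => c * fderiv ℝ u y (e4 i) := by
    funext y
    change fderiv ℝ (c • u) y (e4 i) = _
    rw [fderiv_const_smul_field]
    rfl
  rw [hu]
  change fderiv ℝ (c • fun y => fderiv ℝ u y (e4 i)) x (e4 i) = _
  rw [fderiv_const_smul_field]
  rfl

/-- Leibniz rule for the Laplacian. -/
theorem lap_mul {f g : E4 → ℝ} {x : E4} (hf : ContDiffAt ℝ 2 f x) (hg : ContDiffAt ℝ 2 g x) :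
    lap (fun y => f y * g y) x = f x * lap g x
      + 2 * ∑ i, fderiv ℝ f x (e4 i) * fderiv ℝ g x (e4 i) + lap f x * g x := by
  simp only [lap, Finset.mul_sum, Finset.sum_mul, ← Finset.sum_add_distrib]
  refine Finset.sum_congr rfl fun i _ => ?_
  have hdir {u : E4 → ℝ} (hu : ContDiffAt ℝ 2 u x) :
      DifferentiableAt ℝ (fun y => fderiv ℝ u y (e4 i)) x :=
    ((hu.fderiv_right (m := 1) (by norm_num)).differentiableAt (by norm_num)).clm_apply
      (differentiableAt_const _)
  have hnear {u : E4 → ℝ} (hu : ContDiffAt ℝ 2 u x) : ∀ᶠ y in 𝓝 x, DifferentiableAt ℝ u y :=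
    (hu.eventually (by simp)).mono fun y hy => hy.differentiableAt (by norm_num)
  have hev : (fun y => fderiv ℝ (fun z => f z * g z) y (e4 i)) =ᶠ[𝓝 x]
      fun y => f y * fderiv ℝ g y (e4 i) + g y * fderiv ℝ f y (e4 i) := by
    filter_upwards [hnear hf, hnear hg] with y hfy hgy
    rw [fderiv_fun_mul hfy hgy]
    simp
  have hfx := hf.differentiableAt (by norm_num)
  have hgx := hg.differentiableAt (by norm_num)
  rw [hev.fderiv_eq, fderiv_fun_add (hfx.fun_mul (hdir hg)) (hgx.fun_mul (hdir hf)),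
    fderiv_fun_mul hfx (hdir hg), fderiv_fun_mul hgx (hdir hf)]
  simp only [add_apply, smul_apply, smul_eq_mul]
  ring

theorem hasFDerivAt_norm_sq (y : E4) :
    HasFDerivAt (fun z : E4 => ‖z‖ ^ 2) (2 • innerSL ℝ y) y :=
  (hasStrictFDerivAt_norm_sq y).hasFDerivAt

theorem innerSL_e4 (y : E4) (i : Fin 4) : innerSL ℝ y (e4 i) = y i := by
  simp [e4, EuclideanSpace.inner_single_right]

theorem fderiv_apply_coord (x : E4) (i : Fin 4) : fderiv ℝ (fun y : E4 => y i) x (e4 i) = 1 := by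
  change fderiv ℝ (EuclideanSpace.proj i : E4 →L[ℝ] ℝ) x (e4 i) = 1
  rw [ContinuousLinearMap.fderiv]
  simp [e4]

theorem fderiv_norm_sq_sub_one (y v : E4) :
    fderiv ℝ (fun z : E4 => ‖z‖ ^ 2 - 1) y v = 2 * innerSL ℝ y v := by
  rw [((hasFDerivAt_norm_sq y).sub_const 1).fderiv]
  simp

theorem lap_norm_sq_sub_one (x : E4) : lap (fun z : E4 => ‖z‖ ^ 2 - 1) x = 8 := by
  simp only [lap, fderiv_norm_sq_sub_one, innerSL_e4]
  have hi (i : Fin 4) : fderiv ℝ (fun y : E4 => 2 * y i) x (e4 i) = 2 := by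
    rw [fderiv_const_mul (by fun_prop)]
    simp [fderiv_apply_coord]
  simp only [hi]
  norm_num

theorem hasFDerivAt_norm_sq_rpow (a : ℝ) {y : E4} (hy : y ≠ 0) :
    HasFDerivAt (fun z : E4 => (‖z‖ ^ 2) ^ a)
      ((a * (‖y‖ ^ 2) ^ (a - 1)) • (2 • innerSL ℝ y)) y :=
  (hasFDerivAt_norm_sq y).rpow_const (Or.inl (by positivity))

theorem fderiv_norm_sq_rpow (a : ℝ) {y : E4} (hy : y ≠ 0) (v : E4) :
    fderiv ℝ (fun z : E4 => (‖z‖ ^ 2) ^ a) y v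
      = 2 * a * ((‖y‖ ^ 2) ^ (a - 1) * innerSL ℝ y v) := by
  rw [(hasFDerivAt_norm_sq_rpow a hy).fderiv]
  simp
  ring

theorem lap_norm_sq_rpow (a : ℝ) {x : E4} (hx : ‖x‖ = 1) :
    lap (fun z : E4 => (‖z‖ ^ 2) ^ a) x = 4 * a * (a + 1) := by
  have hx0 : x ≠ 0 := by
    rintro rfl
    simp at hx
  have hi (i : Fin 4) :
      fderiv ℝ (fun y => fderiv ℝ (fun z : E4 => (‖z‖ ^ 2) ^ a) y (e4 i)) x (e4 i)
        = 2 * a + 4 * a * (a - 1) * x i ^ 2 := by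
    have hev : (fun y => fderiv ℝ (fun z : E4 => (‖z‖ ^ 2) ^ a) y (e4 i)) =ᶠ[𝓝 x]
        fun y => 2 * a * ((‖y‖ ^ 2) ^ (a - 1) * y i) := by
      filter_upwards [isOpen_ne.mem_nhds hx0] with y hy
      rw [fderiv_norm_sq_rpow a hy, innerSL_e4]
    have hd := (hasFDerivAt_norm_sq_rpow (a - 1) hx0).differentiableAt
    have hc : DifferentiableAt ℝ (fun y : E4 => y i) x := by fun_prop
    rw [hev.fderiv_eq, fderiv_const_mul (hd.fun_mul hc), fderiv_fun_mul hd hc]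
    simp only [add_apply, smul_apply, smul_eq_mul, fderiv_apply_coord,
      fderiv_norm_sq_rpow _ hx0, innerSL_e4, hx, one_pow, Real.one_rpow]
    ring
  have hsum : ∑ i, x i ^ 2 = 1 := by
    rw [← EuclideanSpace.real_norm_sq_eq, hx, one_pow]
  simp only [lap, hi, Finset.sum_add_distrib, ← Finset.mul_sum, hsum]
  simp
  ring

theorem sphLap_congr {f g : E4 → ℝ} (hfg : ∀ y : E4, ‖y‖ = 1 → f y = g y) {x : E4}
    (hx : x ≠ 0) : sphLap f x = sphLap g x := by
  refine lap_congr ?_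
  filter_upwards [isOpen_ne.mem_nhds hx] with y hy
  exact hfg _ (norm_smul_inv_norm (𝕜 := ℝ) hy)

/-- A harmonic function homogeneous of degree `k` restricts to an eigenfunction of the spherical
Laplacian. -/
theorem sphLap_of_harmonic_homogeneous {k : ℕ} {h : E4 → ℝ} (hsmooth : ContDiff ℝ 2 h)
    (hharm : ∀ x : E4, lap h x = 0) (hhom : ∀ (t : ℝ) (x : E4), h (t • x) = t ^ k * h x)
    {x : E4} (hx : ‖x‖ = 1) : sphLap h x = -(k * (k + 2)) * h x := by
  have hx0 : x ≠ 0 := by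
    rintro rfl
    simp at hx
  have hpow (y : E4) : h (‖y‖⁻¹ • y) = (‖y‖ ^ 2) ^ (-(k : ℝ) / 2) * h y := by
    rw [hhom, ← Real.rpow_natCast ‖y‖ 2, ← Real.rpow_mul (norm_nonneg y)]
    have hk : ((2 : ℕ) : ℝ) * (-(k : ℝ) / 2) = -k := by
      push_cast
      ring
    rw [hk, Real.rpow_neg (norm_nonneg y), Real.rpow_natCast, inv_pow]
  have hcd : ContDiffAt ℝ 2 (fun y : E4 => (‖y‖ ^ 2) ^ (-(k : ℝ) / 2)) x :=
    (contDiff_norm_sq ℝ).contDiffAt.rpow_const_of_ne (by positivity)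
  have hEuler := fderiv_self_of_homogeneous hhom (x := x) (hsmooth.differentiable (by norm_num) x)
  simp only [sphLap, hpow]
  rw [lap_mul hcd hsmooth.contDiffAt, hharm, lap_norm_sq_rpow _ hx]
  simp only [fderiv_norm_sq_rpow _ hx0, innerSL_e4, hx, one_pow, Real.one_rpow, one_mul,
    mul_assoc, ← Finset.mul_sum, sum_apply_mul_clm, hEuler]
  ring

theorem lap_norm_sq_sub_one_mul {k : ℕ} {h : E4 → ℝ} (hsmooth : ContDiff ℝ 2 h)
    (hharm : ∀ x : E4, lap h x = 0) (hhom : ∀ (t : ℝ) (x : E4), h (t • x) = t ^ k * h x)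
    (x : E4) : lap (fun y => (‖y‖ ^ 2 - 1) * h y) x = (4 * k + 8) * h x := by
  have hEuler := fderiv_self_of_homogeneous hhom (x := x) (hsmooth.differentiable (by norm_num) x)
  rw [lap_mul ((contDiff_norm_sq ℝ).sub contDiff_const).contDiffAt hsmooth.contDiffAt, hharm,
    lap_norm_sq_sub_one]
  simp only [fderiv_norm_sq_sub_one, innerSL_e4, mul_assoc, ← Finset.mul_sum, sum_apply_mul_clm,
    hEuler]
  ring

theorem muM_norm_sq_sub_one_mul {h : E4 → ℝ} {x : E4} (hd : DifferentiableAt ℝ h x)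
    (hx : ‖x‖ = 1) : muM (fun y => (‖y‖ ^ 2 - 1) * h y) x = -2 * h x := by
  rw [muM, fderiv_fun_mul ((hasFDerivAt_norm_sq x).sub_const 1).differentiableAt hd]
  simp only [add_apply, smul_apply, smul_eq_mul, fderiv_norm_sq_sub_one, innerSL_apply_apply,
    real_inner_self_eq_norm_sq, hx]
  ring

/-- If `h` is a harmonic polynomial on `ℝ⁴`, homogeneous of degree `k`, and
`F(x) = (‖x‖² - 1) h(x)`, then on the unit sphere `μ F = -2h` and `P₃^{S³} F = 0`.
(Here `muM` is the inward normal derivative `μ u (x) = -⟨∇u(x), x⟩`, and `P3M` is the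
operator `P₃^{S³} u = (1/2)μ(Δu) + Δ_{S³}(μ u) - Δ_{S³}(u|_{S³})`.) -/
theorem stmt18 (k : ℕ) (h : E4 → ℝ) (hpoly : IsPolyFun h)
    (hharm : ∀ x : E4, lap h x = 0)
    (hhom : ∀ (t : ℝ) (x : E4), h (t • x) = t ^ k * h x) :
    (∀ x : E4, ‖x‖ = 1 → muM (fun y => (‖y‖ ^ 2 - 1) * h y) x = -2 * h x) ∧
    (∀ x : E4, ‖x‖ = 1 → P3M (fun y => (‖y‖ ^ 2 - 1) * h y) x = 0) := by
  have hsmooth : ContDiff ℝ 2 h := hpoly.contDiff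
  have hdiff : Differentiable ℝ h := hsmooth.differentiable (by norm_num)
  have hmu (x : E4) (hx : ‖x‖ = 1) : muM (fun y => (‖y‖ ^ 2 - 1) * h y) x = -2 * h x :=
    muM_norm_sq_sub_one_mul (hdiff x) hx
  refine ⟨hmu, fun x hx => ?_⟩
  have hx0 : x ≠ 0 := by
    rintro rfl
    simp at hx
  have hlap : lap (fun y => (‖y‖ ^ 2 - 1) * h y) = fun y => (4 * k + 8) * h y :=
    funext (lap_norm_sq_sub_one_mul hsmooth hharm hhom)
  have hmulap : muM (fun y => (4 * k + 8) * h y) x = -((4 * k + 8) * (k * h x)) := by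
    rw [muM, fderiv_const_mul (hdiff x), smul_apply, smul_eq_mul,
      fderiv_self_of_homogeneous hhom (hdiff x)]
  have hrestr : sphLap (fun y => (‖y‖ ^ 2 - 1) * h y) x = 0 := by
    rw [sphLap_congr (g := fun _ => 0) (fun y hy => by simp [hy]) hx0]
    simp [sphLap, lap]
  have hnormal : sphLap (muM fun y => (‖y‖ ^ 2 - 1) * h y) x = -2 * (-(k * (k + 2)) * h x) := by
    rw [sphLap_congr hmu hx0, ← sphLap_of_harmonic_homogeneous hsmooth hharm hhom hx]
    exact lap_const_mul (-2) (fun y => h (‖y‖⁻¹ • y)) x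
  rw [P3M, hlap, hmulap, hrestr, hnormal]
  ring
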